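/- For any two LR-classes C1 and C2 of binary trees, the element (Σ_{t1∈C1} c_{t1}) ⋆ (Σ_{t2∈C2} c_{t2}) − (Σ_{t2∈C2} c_{t2}) ⋆ (Σ_{t1∈C1} c_{t1}) is a linear combination of the elements Σ_{t∈C} c_t, where C ranges over LR-classes; that is, the linear span of the LR-class sums is a Lie subalgebra for the convolution bracket. -/

import Mathlib

/-- The free module on words of positive integers, with coefficients in `R`.
`ℚ[S_n]` is identified with the span of the permutation words of {1,…,n}. -/
abbrev FW (R : Type) [CommRing R] := (List ℕ) →₀ R

variable {R : Type} [CommRing R]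

/-- Concatenation product, extended bilinearly. -/
noncomputable def catW (x y : FW R) : FW R :=
  x.sum fun u a => y.sum fun v b => Finsupp.single (u ++ v) (a * b)

/-- The bracket [x,y] = x·y − y·x of the concatenation product. -/
noncomputable def brakW (x y : FW R) : FW R := catW x y - catW y x

/-- (Incomplete) binary trees; `nil` is the empty tree. The complete binary tree with
`t.nodes + 1` leaves whose internal nodes form `t` is implicit in the definitions below. -/
inductive BT
  | nil : BT
  | nd : BT → BT → BT
deriving DecidableEq

/-- Number of nodes of a binary tree. -/
def BT.nodes : BT → ℕ
  | .nil => 0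
  | .nd l r => l.nodes + r.nodes + 1

/-- The evaluation T(σ) of the complete binary tree `T` whose internal nodes form `t`, with
leaves labelled left to right by the word `w`: each leaf gets the one-letter word of its label
and each internal node the bracket of concatenation. -/
noncomputable def evalBT : BT → List ℕ → FW R
  | .nil, w => Finsupp.single w 1
  | .nd l r, w => brakW (evalBT l (w.take (l.nodes + 1))) (evalBT r (w.drop (l.nodes + 1)))

/-- The standardization of a word with distinct letters: each letter is replaced by its rank. -/
def stdW (w : List ℕ) : List ℕ := w.map fun x => (w.filter (· ≤ x)).length

/-- The set of permutation words of {1, …, n}. -/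
def permWords (n : ℕ) : Finset (List ℕ) := (List.range' 1 n).permutations.toFinset

/-- Convolution α⋆β of two permutation words: the sum of all permutation words γ of size
|α|+|β| with std(γ(1)⋯γ(m)) = α and std(γ(m+1)⋯γ(m+n)) = β. -/
noncomputable def convW (u v : List ℕ) : FW R :=
  ∑ γ ∈ (permWords (u.length + v.length)).filter
      (fun γ => stdW (γ.take u.length) = u ∧ stdW (γ.drop u.length) = v),
    Finsupp.single γ 1

/-- The convolution product, extended bilinearly. -/
noncomputable def starW (x y : FW R) : FW R :=
  x.sum fun u a => y.sum fun v b => (a * b) • convW u v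

/-- Whether the word `w` is an admissible labelling of (the completion of) `t`: at each internal
node, the smallest label lies in the left subtree and the largest in the right subtree. -/
def admB : BT → List ℕ → Bool
  | .nil, _ => true
  | .nd l r, w =>
    admB l (w.take (l.nodes + 1)) && admB r (w.drop (l.nodes + 1))
      && decide ((w.take (l.nodes + 1)).minimum = w.minimum)
      && decide ((w.drop (l.nodes + 1)).maximum = w.maximum)

/-- c_t: the sum of the evaluations T(σ) over all admissible labellings σ of the complete
binary tree whose internal nodes form `t`. -/
noncomputable def cElt (t : BT) : FW R :=
  ∑ w ∈ (permWords (t.nodes + 1)).filter (fun w => admB t w = true), evalBT t w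


/-- The finite set of all binary trees with m nodes. -/
def allBT : ℕ → Finset BT
  | 0 => {BT.nil}
  | m + 1 =>
    (Finset.range (m + 1)).attach.biUnion fun k =>
      ((allBT k.1) ×ˢ (allBT (m - k.1))).image fun p => BT.nd p.1 p.2
decreasing_by
  · exact k.2 |> Finset.mem_range.mp
  · omega

mutual
/-- `LIn t t'`: `t'` is obtained from `t` by an L-move at a vertex `v` of `t` that is the root
of `t` or a right child of its parent: `v` has a right child `w`, and the left subtree of `v`
is exchanged with the left subtree of `w`. (The root of the ambient subtree qualifies.) -/
inductive LIn : BT → BT → Prop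
  | here (t1 t2 t3 : BT) : LIn (BT.nd t1 (BT.nd t2 t3)) (BT.nd t2 (BT.nd t1 t3))
  | congL {l l' : BT} (r : BT) : LSub l l' → LIn (BT.nd l r) (BT.nd l' r)
  | congR (l : BT) {r r' : BT} : LIn r r' → LIn (BT.nd l r) (BT.nd l r')

/-- `LSub t t'`: `t'` is obtained from `t` by an L-move at a vertex that is a right child of
its parent (the root of the ambient subtree itself does not qualify). -/
inductive LSub : BT → BT → Prop
  | congL {l l' : BT} (r : BT) : LSub l l' → LSub (BT.nd l r) (BT.nd l' r)
  | congR (l : BT) {r r' : BT} : LIn r r' → LSub (BT.nd l r) (BT.nd l r')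
end

/-- L-equivalence: the equivalence relation on binary trees generated by L-moves. -/
def LEquiv : BT → BT → Prop := Relation.EqvGen LIn

mutual
/-- `RIn t t'`: `t'` is obtained from `t` by an R-move at a vertex `v` of `t` that is the root
of `t` or a left child of its parent: `v` has a left child `w`, and the right subtree of `v`
is exchanged with the right subtree of `w`. (The root of the ambient subtree qualifies.) -/
inductive RIn : BT → BT → Prop
  | here (t1 t2 t3 : BT) : RIn (BT.nd (BT.nd t3 t2) t1) (BT.nd (BT.nd t3 t1) t2)
  | congL {l l' : BT} (r : BT) : RIn l l' → RIn (BT.nd l r) (BT.nd l' r)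
  | congR (l : BT) {r r' : BT} : RSub r r' → RIn (BT.nd l r) (BT.nd l r')

/-- `RSub t t'`: `t'` is obtained from `t` by an R-move at a vertex that is a left child of its
parent (the root of the ambient subtree itself does not qualify). -/
inductive RSub : BT → BT → Prop
  | congL {l l' : BT} (r : BT) : RIn l l' → RSub (BT.nd l r) (BT.nd l' r)
  | congR (l : BT) {r r' : BT} : RSub r r' → RSub (BT.nd l r) (BT.nd l r')
end

/-- LR-equivalence: the equivalence relation generated by L-moves and R-moves. -/
def LREquiv : BT → BT → Prop := Relation.EqvGen fun t t' => LIn t t' ∨ RIn t t'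

open scoped Classical in
/-- The sum Σ_{s ∈ C} c_s over the LR-class C of the tree t. -/
noncomputable def LRclassSum (t : BT) : FW ℚ :=
  ∑ s ∈ (allBT t.nodes).filter (fun s => LREquiv t s), cElt s

section Concatenation

open Finsupp

theorem sum_sum_ite_apply {x y : FW ℚ} (p q : List ℕ) :
    (∑ u ∈ x.support, ∑ v ∈ y.support, if u = p ∧ v = q then x u * y v else 0) = x p * y q := by
  have inner (u : List ℕ) :
      (∑ v ∈ y.support, if u = p ∧ v = q then x u * y v else 0) =
        if u = p then x u * y q else 0 := by
    by_cases hu : u = p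
    · simp only [hu, true_and, if_true, Finset.sum_ite_eq', mem_support_iff]
      by_cases hq : y q = 0 <;> simp [hq]
    · simp [hu]
  simp only [inner, Finset.sum_ite_eq', mem_support_iff]
  by_cases hp : x p = 0 <;> simp [hp]

/-- Concatenation as a bilinear map. -/
noncomputable def catL : FW ℚ →ₗ[ℚ] FW ℚ →ₗ[ℚ] FW ℚ :=
  LinearMap.mk₂ ℚ catW
    (fun x x' y => by
      unfold catW
      rw [sum_add_index']
      · simp
      · intro u a b
        rw [← sum_add]
        simp [add_mul])
    (fun c x y => by
      unfold catW
      rw [sum_smul_index' (by simp), smul_sum]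
      simp [smul_sum, mul_assoc, -single_mul])
    (fun x y y' => by
      unfold catW
      rw [← sum_add]
      congr 1
      ext1 u
      ext1 a
      rw [sum_add_index'] <;> simp [mul_add])
    (fun c x y => by
      unfold catW
      rw [smul_sum]
      congr 1
      ext1 u
      ext1 a
      rw [sum_smul_index' (by simp), smul_sum]
      simp [mul_left_comm, -single_mul])

theorem catL_apply (x y : FW ℚ) : catL x y = catW x y := rfl

theorem catW_single (u v : List ℕ) (a b : ℚ) :
    catW (single u a) (single v b) = single (u ++ v) (a * b) := by
  simp [catW]

theorem catW_assoc (x y z : FW ℚ) : catW (catW x y) z = catW x (catW y z) := by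
  simp only [← catL_apply]
  induction x using Finsupp.induction_linear with
  | zero => simp
  | add x x' hx hx' => simp [hx, hx']
  | single u a =>
    induction y using Finsupp.induction_linear with
    | zero => simp
    | add y y' hy hy' => simp [hy, hy']
    | single v b =>
      induction z using Finsupp.induction_linear with
      | zero => simp
      | add z z' hz hz' => simp [hz, hz']
      | single w c => simp [catL_apply, catW_single, mul_assoc, -single_mul]

theorem mapDomain_catW (f : ℕ → ℕ) (x y : FW ℚ) :
    mapDomain (List.map f) (catW x y) =
      catW (mapDomain (List.map f) x) (mapDomain (List.map f) y) := by
  simp only [← catL_apply]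
  induction x using Finsupp.induction_linear with
  | zero => simp
  | add x x' hx hx' => simp [hx, hx', mapDomain_add]
  | single u a =>
    induction y using Finsupp.induction_linear with
    | zero => simp
    | add y y' hy hy' => simp only [map_add, hy, hy', mapDomain_add]
    | single v b => simp [catL_apply, catW_single, mapDomain_single, -single_mul]

/-- The commutator of concatenation as a bilinear map. -/
noncomputable def brakL : FW ℚ →ₗ[ℚ] FW ℚ →ₗ[ℚ] FW ℚ := catL - catL.flip

theorem brakL_apply (x y : FW ℚ) : brakL x y = brakW x y := rfl

theorem brakW_antisymm (x y : FW ℚ) : brakW x y = -brakW y x := by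
  simp [brakW]

theorem brakW_jacobi (x y z : FW ℚ) :
    brakW (brakW x y) z = brakW (brakW x z) y + brakW x (brakW y z) := by
  simp only [brakW, ← catL_apply, map_sub, LinearMap.sub_apply]
  simp only [catL_apply, catW_assoc]
  abel

theorem mapDomain_brakW (f : ℕ → ℕ) (x y : FW ℚ) :
    mapDomain (List.map f) (brakW x y) =
      brakW (mapDomain (List.map f) x) (mapDomain (List.map f) y) := by
  have h : ∀ a b : FW ℚ, mapDomain (List.map f) (a - b) =
      mapDomain (List.map f) a - mapDomain (List.map f) b :=
    fun a b => map_sub (mapDomain.addMonoidHom (List.map f)) a b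
  simp only [brakW, h, mapDomain_catW]

theorem catW_apply_eq_sum (x y : FW ℚ) (w : List ℕ) :
    catW x y w = ∑ u ∈ x.support, ∑ v ∈ y.support, if u ++ v = w then x u * y v else 0 := by
  simp [catW, Finsupp.sum, finsetSum_apply, single_apply, -single_mul]

theorem catW_apply_of_length {x : FW ℚ} {m : ℕ} (hx : ∀ u, x u ≠ 0 → u.length = m) (y : FW ℚ)
    (w : List ℕ) : catW x y w = x (w.take m) * y (w.drop m) := by
  rw [catW_apply_eq_sum, ← sum_sum_ite_apply]
  refine Finset.sum_congr rfl fun u hu => Finset.sum_congr rfl fun v _ => ?_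
  have hl := hx u (mem_support_iff.1 hu)
  refine if_congr ⟨?_, ?_⟩ rfl rfl
  · rintro rfl
    simp [← hl]
  · rintro ⟨rfl, rfl⟩
    exact List.take_append_drop m w

theorem exists_append_of_catW_ne_zero {x y : FW ℚ} {w : List ℕ} (h : catW x y w ≠ 0) :
    ∃ u v, x u ≠ 0 ∧ y v ≠ 0 ∧ u ++ v = w := by
  rw [catW_apply_eq_sum] at h
  obtain ⟨u, hu, h⟩ := Finset.exists_ne_zero_of_sum_ne_zero h
  obtain ⟨v, hv, h⟩ := Finset.exists_ne_zero_of_sum_ne_zero h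
  exact ⟨u, v, mem_support_iff.1 hu, mem_support_iff.1 hv, by by_contra hne; simp [hne] at h⟩

theorem convW_apply (u v w : List ℕ) :
    (convW u v : FW ℚ) w =
      if w ∈ permWords (u.length + v.length) ∧
        stdW (w.take u.length) = u ∧ stdW (w.drop u.length) = v then 1 else 0 := by
  simp [convW, finsetSum_apply, single_apply]

theorem starW_apply_of_length {x y : FW ℚ} {m n : ℕ} (hx : ∀ u, x u ≠ 0 → u.length = m)
    (hy : ∀ v, y v ≠ 0 → v.length = n) (w : List ℕ) :
    starW x y w =
      if w ∈ permWords (m + n) then x (stdW (w.take m)) * y (stdW (w.drop m)) else 0 := by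
  have key : starW x y w = ∑ u ∈ x.support, ∑ v ∈ y.support,
      x u * y v * (convW u v : FW ℚ) w := by
    simp [starW, Finsupp.sum, finsetSum_apply]
  rw [key]
  split_ifs with hw
  · rw [← sum_sum_ite_apply]
    refine Finset.sum_congr rfl fun u hu => Finset.sum_congr rfl fun v hv => ?_
    rw [convW_apply, hx u (mem_support_iff.1 hu), hy v (mem_support_iff.1 hv)]
    simp [hw, eq_comm]
  · refine Finset.sum_eq_zero fun u hu => Finset.sum_eq_zero fun v hv => ?_
    rw [convW_apply, hx u (mem_support_iff.1 hu), hy v (mem_support_iff.1 hv)]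
    simp [hw]

end Concatenation

section Cuts

/-- For a binary tree `t`, deleting a node `e` (an edge of the associated bicoloured tree) leaves
two trees: the one that keeps the position of `t`, and the one that falls off. `t.cutSum s F` sums
`±F kept lost` over all nodes, where `s` says whether `t` sits in the position of a left child. -/
def BT.cutSum : BT → Bool → (BT → BT → ℚ) → ℚ
  | .nil, _, _ => 0
  | .nd l r, s, F =>
    (if s then F l r else -F r l) + l.cutSum true (fun a b => F (.nd a r) b) +
      r.cutSum false (fun a b => F (.nd l a) b)

theorem BT.cutSum_true_eq_false {F : BT → BT → ℚ} (hF : ∀ a b, F a b = -F b a) (t : BT) :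
    t.cutSum true F = t.cutSum false F := by
  cases t with
  | nil => rfl
  | nd l r => simp [cutSum, hF l r]

/-- One L- or R-move inside a tree which sits in the position of a left (`true`) or right (`false`)
child. -/
inductive LRStep : Bool → BT → BT → Prop
  | left (s : Bool) {l l' : BT} (r : BT) : LRStep true l l' → LRStep s (.nd l r) (.nd l' r)
  | right (s : Bool) (l : BT) {r r' : BT} : LRStep false r r' → LRStep s (.nd l r) (.nd l r')
  | moveR (t1 t2 t3 : BT) : LRStep true (.nd (.nd t3 t2) t1) (.nd (.nd t3 t1) t2)
  | moveL (t1 t2 t3 : BT) : LRStep false (.nd t1 (.nd t2 t3)) (.nd t2 (.nd t1 t3))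

theorem LRStep.nodes_eq {s : Bool} {t t' : BT} (h : LRStep s t t') : t.nodes = t'.nodes := by
  induction h <;> simp only [BT.nodes] <;> omega

theorem LRStep.cutSum_eq {s : Bool} {t t' : BT} (h : LRStep s t t') :
    ∀ F : BT → BT → ℚ, (∀ a a' b, LRStep s a a' → F a b = F a' b) →
      (∀ a b b' p, LRStep p b b' → F a b = F a b') → t.cutSum s F = t'.cutSum s F := by
  induction h with
  | @left s l l' r h ih =>
    intro F h1 h2
    have e1 := ih (fun a b => F (.nd a r) b) (fun a a' b ha => h1 _ _ _ (ha.left s r))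
      (fun a b b' p hb => h2 _ _ _ p hb)
    have e2 : (fun a b => F (.nd l a) b) = fun a b => F (.nd l' a) b := by
      ext a b
      exact h1 _ _ _ (h.left s a)
    simp only [BT.cutSum, e1, e2]
    cases s
    · simp [h2 r l l' _ h]
    · simp [h1 l l' r h]
  | @right s l r r' h ih =>
    intro F h1 h2
    have e1 := ih (fun a b => F (.nd l a) b) (fun a a' b ha => h1 _ _ _ (ha.right s l))
      (fun a b b' p hb => h2 _ _ _ p hb)
    have e2 : (fun a b => F (.nd a r) b) = fun a b => F (.nd a r') b := by
      ext a b
      exact h1 _ _ _ (h.right s a)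
    simp only [BT.cutSum, e1, e2]
    cases s
    · simp [h1 r r' l h]
    · simp [h2 l r r' _ h]
  | moveR t1 t2 t3 =>
    intro F h1 _
    have e (a b c : BT) : F (.nd (.nd a b) c) = F (.nd (.nd a c) b) :=
      funext fun d => h1 _ _ d (.moveR c b a)
    simp only [BT.cutSum, if_true, funext fun a => e a t2 t1, funext fun a => e t3 a t1,
      funext fun a => e t3 t2 a]
    ring
  | moveL t1 t2 t3 =>
    intro F h1 _
    have e (a b c : BT) : F (.nd a (.nd b c)) = F (.nd b (.nd a c)) :=
      funext fun d => h1 _ _ d (.moveL a b c)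
    simp only [BT.cutSum, Bool.false_eq_true, if_false, funext fun a => e t1 t2 a,
      funext fun a => e t1 a t3, funext fun a => e a t2 t3]
    ring

mutual
theorem LIn.lrStep {t t' : BT} : LIn t t' → LRStep false t t'
  | .here t1 t2 t3 => .moveL t1 t2 t3
  | .congL r h => .left false r (h.lrStep true)
  | .congR l h => .right false l h.lrStep

theorem LSub.lrStep {t t' : BT} (s : Bool) : LSub t t' → LRStep s t t'
  | .congL r h => .left s r (h.lrStep true)
  | .congR l h => .right s l h.lrStep
end

mutual
theorem RIn.lrStep {t t' : BT} : RIn t t' → LRStep true t t'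
  | .here t1 t2 t3 => .moveR t1 t2 t3
  | .congL r h => .left true r h.lrStep
  | .congR l h => .right true l (h.lrStep false)

theorem RSub.lrStep {t t' : BT} (s : Bool) : RSub t t' → LRStep s t t'
  | .congL r h => .left s r h.lrStep
  | .congR l h => .right s l (h.lrStep false)
end

theorem LSub.lIn {t t' : BT} : LSub t t' → LIn t t'
  | .congL r h => .congL r h
  | .congR l h => .congR l h

theorem RSub.rIn {t t' : BT} : RSub t t' → RIn t t'
  | .congL r h => .congL r h
  | .congR l h => .congR l h

theorem LRStep.lIn_or_rIn {s : Bool} {t t' : BT} (h : LRStep s t t') :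
    (LIn t t' ∨ RIn t t') ∧ (s = true → LSub t t' ∨ RIn t t') ∧
      (s = false → LIn t t' ∨ RSub t t') := by
  suffices h' : (s = true → LSub t t' ∨ RIn t t') ∧ (s = false → LIn t t' ∨ RSub t t') by
    refine ⟨?_, h'⟩
    cases s
    · exact (h'.2 rfl).imp_right RSub.rIn
    · exact (h'.1 rfl).imp_left LSub.lIn
  induction h with
  | left s r _ ih =>
    rcases ih.1 rfl with h | h
    · exact ⟨fun _ => .inl (.congL r h), fun _ => .inl (.congL r h)⟩
    · exact ⟨fun _ => .inr (.congL r h), fun _ => .inr (.congL r h)⟩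
  | right s l _ ih =>
    rcases ih.2 rfl with h | h
    · exact ⟨fun _ => .inl (.congR l h), fun _ => .inl (.congR l h)⟩
    · exact ⟨fun _ => .inr (.congR l h), fun _ => .inr (.congR l h)⟩
  | moveR t1 t2 t3 => exact ⟨fun _ => .inr (.here _ _ _), nofun⟩
  | moveL t1 t2 t3 => exact ⟨nofun, fun _ => .inl (.here _ _ _)⟩

theorem LRStep.lrEquiv {s : Bool} {t t' : BT} (h : LRStep s t t') : LREquiv t t' :=
  .rel _ _ h.lIn_or_rIn.1

theorem LREquiv.eq_of_lrStep {α : Type*} {f : BT → α}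
    (hf : ∀ s t t', LRStep s t t' → f t = f t') {t t' : BT} (h : LREquiv t t') : f t = f t' := by
  induction h with
  | rel t t' h => exact h.elim (fun h => hf _ _ _ h.lrStep) fun h => hf _ _ _ h.lrStep
  | refl t => rfl
  | symm _ _ _ ih => exact ih.symm
  | trans _ _ _ _ _ ih ih' => exact ih.trans ih'

theorem LREquiv.nodes_eq {t t' : BT} (h : LREquiv t t') : t.nodes = t'.nodes :=
  h.eq_of_lrStep fun _ _ _ h => h.nodes_eq

theorem LREquiv.cutSum_eq {F : BT → BT → ℚ} (hF : ∀ a b, F a b = -F b a)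
    (hF' : ∀ a a' b, LREquiv a a' → F a b = F a' b) {t t' : BT} (h : LREquiv t t') :
    t.cutSum true F = t'.cutSum true F := by
  refine h.eq_of_lrStep (f := fun t => t.cutSum true F) fun s t t' h => ?_
  have key : t.cutSum s F = t'.cutSum s F :=
    h.cutSum_eq F (fun a a' b ha => hF' _ _ _ ha.lrEquiv) fun a b b' p hb => by
      rw [hF, hF a, hF' _ _ _ hb.lrEquiv]
  cases s
  · rwa [BT.cutSum_true_eq_false hF, BT.cutSum_true_eq_false hF]
  · exact key

end Cuts

/-- Complete binary trees whose leaves are labelled by natural numbers. -/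
inductive LabTree
  | leaf : ℕ → LabTree
  | nd : LabTree → LabTree → LabTree
deriving DecidableEq

namespace LabTree

open Finsupp

/-- The tree of internal nodes. -/
def shape : LabTree → BT
  | leaf _ => .nil
  | nd l r => .nd l.shape r.shape

/-- The leaf labels, read from left to right. -/
def word : LabTree → List ℕ
  | leaf a => [a]
  | nd l r => l.word ++ r.word

/-- The set of leaf labels. -/
def labels (T : LabTree) : Finset ℕ := T.word.toFinset

/-- The leftmost label, which is the smallest one in an admissible tree. -/
def first : LabTree → ℕ
  | leaf a => a
  | nd l _ => l.first

/-- The rightmost label, which is the largest one in an admissible tree. -/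
def last : LabTree → ℕ
  | leaf a => a
  | nd _ r => r.last

/-- Admissibility of a labelling by pairwise distinct labels. -/
def Adm : LabTree → Prop
  | leaf _ => True
  | nd l r => l.Adm ∧ r.Adm ∧ Disjoint l.labels r.labels ∧ l.first < r.first ∧ l.last < r.last

/-- The evaluation of a labelled tree as an iterated commutator. -/
noncomputable def ev : LabTree → FW ℚ
  | leaf a => single [a] 1
  | nd l r => brakW l.ev r.ev

@[simp]
theorem labels_leaf (a : ℕ) : (leaf a).labels = {a} := rfl

@[simp]
theorem labels_nd (l r : LabTree) : (nd l r).labels = l.labels ∪ r.labels :=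
  List.toFinset_append

theorem length_word (T : LabTree) : T.word.length = T.shape.nodes + 1 := by
  induction T with
  | leaf a => rfl
  | nd l r hl hr => simp [word, shape, BT.nodes, hl, hr]; omega

theorem first_mem (T : LabTree) : T.first ∈ T.labels := by
  induction T with
  | leaf a => simp [first]
  | nd l r hl _ => simp [first, hl]

theorem last_mem (T : LabTree) : T.last ∈ T.labels := by
  induction T with
  | leaf a => simp [last]
  | nd l r _ hr => simp [last, hr]

theorem Adm.bounds {T : LabTree} (h : T.Adm) : ∀ x ∈ T.labels, T.first ≤ x ∧ x ≤ T.last := by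
  induction T with
  | leaf a => simp [first, last]
  | nd l r hl hr =>
    obtain ⟨h1, h2, -, h4, h5⟩ := h
    intro x hx
    rw [labels_nd, Finset.mem_union] at hx
    simp only [first, last]
    rcases hx with hx | hx
    · have := hl h1 x hx; omega
    · have := hr h2 x hx; omega

theorem Adm.nodup_word {T : LabTree} (h : T.Adm) : T.word.Nodup := by
  induction T with
  | leaf a => simp [word]
  | nd l r hl hr =>
    exact (hl h.1).append (hr h.2.1) (List.disjoint_toFinset_iff_disjoint.1 h.2.2.1)

theorem perm_of_ev_ne_zero {T : LabTree} {w : List ℕ} (h : T.ev w ≠ 0) : w.Perm T.word := by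
  induction T generalizing w with
  | leaf a =>
    rw [ev, single_apply] at h
    simp only [ne_eq, ite_eq_right_iff, not_forall] at h
    obtain ⟨rfl, -⟩ := h
    exact .refl _
  | nd l r hl hr =>
    rw [ev, brakW, Finsupp.sub_apply] at h
    by_cases h1 : catW l.ev r.ev w = 0
    · have h2 : catW r.ev l.ev w ≠ 0 := by
        intro h2
        simp [h1, h2] at h
      obtain ⟨u, v, hu, hv, rfl⟩ := exists_append_of_catW_ne_zero h2
      exact ((hr hu).append (hl hv)).trans List.perm_append_comm
    · obtain ⟨u, v, hu, hv, rfl⟩ := exists_append_of_catW_ne_zero h1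
      exact (hl hu).append (hr hv)

theorem length_of_ev_ne_zero {T : LabTree} {w : List ℕ} (h : T.ev w ≠ 0) :
    w.length = T.shape.nodes + 1 := by
  rw [(perm_of_ev_ne_zero h).length_eq, length_word]

theorem toFinset_of_ev_ne_zero {T : LabTree} {w : List ℕ} (h : T.ev w ≠ 0) :
    w.toFinset = T.labels :=
  List.toFinset_eq_of_perm _ _ (perm_of_ev_ne_zero h)

/-- The analogue of `BT.cutSum` for labelled trees. -/
def cutSum : LabTree → Bool → (LabTree → LabTree → ℚ) → ℚ
  | leaf _, _, _ => 0
  | nd l r, s, F =>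
    (if s then F l r else -F r l) + l.cutSum true (fun a b => F (nd a r) b) +
      r.cutSum false (fun a b => F (nd l a) b)

theorem cutSum_shape (T : LabTree) (s : Bool) (F : BT → BT → ℚ) :
    T.cutSum s (fun a b => F a.shape b.shape) = T.shape.cutSum s F := by
  induction T generalizing s F with
  | leaf a => rfl
  | nd l r hl hr =>
    simp only [cutSum, shape, BT.cutSum, ← hl, ← hr]

theorem cutSum_true_eq_false {F : LabTree → LabTree → ℚ} (hF : ∀ a b, F a b = -F b a)
    (T : LabTree) : T.cutSum true F = T.cutSum false F := by
  cases T with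
  | leaf a => rfl
  | nd l r => simp [cutSum, hF l r]

theorem cutSum_zero (T : LabTree) (s : Bool) : T.cutSum s (fun _ _ => 0) = 0 := by
  induction T generalizing s with
  | leaf a => rfl
  | nd l r hl hr => simp [cutSum, hl, hr]

theorem cutSum_sum {ι : Type*} (S : Finset ι) (T : LabTree) (s : Bool)
    (F : ι → LabTree → LabTree → ℚ) :
    T.cutSum s (fun a b => ∑ i ∈ S, F i a b) = ∑ i ∈ S, T.cutSum s (F i) := by
  induction T generalizing s F with
  | leaf a => simp [cutSum]
  | nd l r hl hr =>
    simp only [cutSum, hl, hr, Finset.sum_add_distrib]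
    cases s <;> simp

theorem cutSum_mul (c : ℚ) (T : LabTree) (s : Bool) (F : LabTree → LabTree → ℚ) :
    T.cutSum s (fun a b => c * F a b) = c * T.cutSum s F := by
  induction T generalizing s F with
  | leaf a => simp [cutSum]
  | nd l r hl hr =>
    simp only [cutSum, hl, hr, mul_add]
    cases s <;> simp

/-- The properties shared by all pairs (kept part, lost part) obtained by deleting a node of an
admissible tree `T` in the position of a left (`true`) or right (`false`) child. -/
structure IsCut (s : Bool) (T a b : LabTree) : Prop where
  adm_left : a.Adm
  adm_right : b.Adm
  disjoint : Disjoint a.labels b.labels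
  union : a.labels ∪ b.labels = T.labels
  first_eq : s = true → a.first = T.first
  last_eq : s = false → a.last = T.last

theorem IsCut.bounds {s : Bool} {T a b : LabTree} (h : IsCut s T a b) (hT : T.Adm) :
    T.first ≤ a.first ∧ a.last ≤ T.last ∧ T.first ≤ b.first ∧ b.last ≤ T.last := by
  have hm (x : ℕ) (hx : x ∈ a.labels ∪ b.labels) : T.first ≤ x ∧ x ≤ T.last :=
    hT.bounds x (h.union ▸ hx)
  exact ⟨(hm _ (Finset.mem_union_left _ a.first_mem)).1,
    (hm _ (Finset.mem_union_left _ a.last_mem)).2,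
    (hm _ (Finset.mem_union_right _ b.first_mem)).1,
    (hm _ (Finset.mem_union_right _ b.last_mem)).2⟩

theorem IsCut.nd_left {l r a b : LabTree} (s : Bool) (hT : (nd l r).Adm)
    (h : IsCut true l a b) : IsCut s (nd l r) (nd a r) b := by
  obtain ⟨h1, h2, h3, h4, h5⟩ := hT
  have hb := h.bounds h1
  have hf := h.first_eq rfl
  have hd := h.disjoint
  rw [← h.union, Finset.disjoint_union_left] at h3
  refine ⟨⟨h.adm_left, h2, h3.1, by omega, by omega⟩, h.adm_right, ?_, ?_, fun _ => hf,
    fun _ => rfl⟩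
  · rw [labels_nd, Finset.disjoint_union_left]
    exact ⟨hd, h3.2.symm⟩
  · rw [labels_nd, labels_nd, ← h.union, Finset.union_right_comm]

theorem IsCut.nd_right {l r a b : LabTree} (s : Bool) (hT : (nd l r).Adm)
    (h : IsCut false r a b) : IsCut s (nd l r) (nd l a) b := by
  obtain ⟨h1, h2, h3, h4, h5⟩ := hT
  have hb := h.bounds h2
  have hf := h.last_eq rfl
  have hd := h.disjoint
  rw [← h.union, Finset.disjoint_union_right] at h3
  refine ⟨⟨h1, h.adm_left, h3.1, by omega, by omega⟩, h.adm_right, ?_, ?_, fun _ => rfl,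
    fun _ => hf⟩
  · rw [labels_nd, Finset.disjoint_union_left]
    exact ⟨h3.2, hd⟩
  · rw [labels_nd, labels_nd, ← h.union, Finset.union_assoc]

theorem cutSum_congr {T : LabTree} (hT : T.Adm) {s : Bool} {F G : LabTree → LabTree → ℚ}
    (h : ∀ a b, IsCut s T a b → F a b = G a b) : T.cutSum s F = T.cutSum s G := by
  induction T generalizing s F G with
  | leaf a => rfl
  | nd l r hl hr =>
    simp only [cutSum]
    congr 1
    · congr 1
      · obtain ⟨h1, h2, h3, h4, h5⟩ := hT
        cases s
        · simpa using h r l ⟨h2, h1, h3.symm, by rw [labels_nd, Finset.union_comm], nofun,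
            fun _ => rfl⟩
        · simpa using h l r ⟨h1, h2, h3, by rw [labels_nd], fun _ => rfl, nofun⟩
      · exact hl hT.1 fun a b hab => h _ _ (hab.nd_left s hT)
    · exact hr hT.2.1 fun a b hab => h _ _ (hab.nd_right s hT)

theorem cutSum_eq_zero {T : LabTree} (hT : T.Adm) {s : Bool} {F : LabTree → LabTree → ℚ}
    (h : ∀ a b, IsCut s T a b → F a b = 0) : T.cutSum s F = 0 :=
  (cutSum_congr hT h).trans (cutSum_zero T s)

/-- The antisymmetrised indicator function of the pair `(A, B)`. -/
def pairInd (A B a b : LabTree) : ℚ :=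
  (if a = A ∧ b = B then 1 else 0) - if b = A ∧ a = B then 1 else 0

theorem pairInd_antisymm (A B a b : LabTree) : pairInd A B a b = -pairInd A B b a := by
  simp [pairInd]

theorem pairInd_swap (A B a b : LabTree) : pairInd A B a b = -pairInd B A a b := by
  simp [pairInd, and_comm]

theorem labels_of_cutSum_pairInd_ne_zero {T A B : LabTree} (hT : T.Adm) {s : Bool}
    (h : T.cutSum s (pairInd A B) ≠ 0) : T.labels = A.labels ∪ B.labels := by
  by_contra hne
  refine h (cutSum_eq_zero hT fun a b hab => ?_)
  rw [pairInd, if_neg, if_neg, sub_zero]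
  · rintro ⟨rfl, rfl⟩
    exact hne (by rw [← hab.union, Finset.union_comm])
  · rintro ⟨rfl, rfl⟩
    exact hne hab.union.symm

theorem cutSum_pairInd_nested {A B T : LabTree} (hT : T.Adm) (hf : A.first < B.first)
    (hl : A.last < B.last) :
    T.cutSum true (pairInd A B) = if T = nd A B then 1 else 0 := by
  cases T with
  | leaf a => simp [cutSum]
  | nd L R =>
    have ⟨h1, h2, _, h4, h5⟩ := hT
    rw [cutSum, cutSum_eq_zero h1, cutSum_eq_zero h2]
    · have hne : ¬(R = A ∧ L = B) := by
        rintro ⟨rfl, rfl⟩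
        omega
      simp [pairInd, hne]
    all_goals
      intro a b hab
      rw [pairInd, if_neg, if_neg, sub_zero]
    · rintro ⟨rfl, rfl⟩
      have := hab.bounds h2
      simp only [first, last] at *
      omega
    · rintro ⟨rfl, rfl⟩
      have := hab.bounds h2
      have := hab.last_eq rfl
      simp only [first, last] at *
      omega
    · rintro ⟨rfl, rfl⟩
      have := hab.bounds h1
      have := hab.first_eq rfl
      simp only [first, last] at *
      omega
    · rintro ⟨rfl, rfl⟩
      have := hab.bounds h1
      simp only [first, last] at *
      omega

theorem cutSum_pairInd_nd {U V B L R : LabTree} (hT : (nd L R).Adm) (hA : (nd U V).Adm)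
    (hB : B.Adm) (hf : U.first < B.first) (hl : B.last < V.last) :
    (nd L R).cutSum true (pairInd (nd U V) B) =
      (if R = V then L.cutSum true (pairInd U B) else 0) +
        if L = U then R.cutSum true (pairInd V B) else 0 := by
  have ⟨h1, h2, _, h4, h5⟩ := hT
  have ⟨_, _, _, g4, g5⟩ := hA
  have hBb := hB.bounds _ B.first_mem
  have hroot : pairInd (nd U V) B L R = 0 := by
    rw [pairInd, if_neg, if_neg, sub_zero]
    · rintro ⟨rfl, rfl⟩
      simp only [first] at *
      omega
    · rintro ⟨rfl, rfl⟩
      simp only [last] at *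
      omega
  rw [cutSum, if_pos rfl, hroot, zero_add]
  congr 1
  · have hc (a b : LabTree) (hab : IsCut true L a b) : pairInd (nd U V) B (nd a R) b =
        if R = V then pairInd U B a b else 0 := by
      have hb := hab.bounds h1
      have hfe := hab.first_eq rfl
      have e1 : ¬(b = nd U V ∧ nd a R = B) := by
        rintro ⟨rfl, rfl⟩
        simp only [first] at *
        omega
      have e2 : ¬(b = U ∧ a = B) := by
        rintro ⟨rfl, rfl⟩
        omega
      rw [pairInd, pairInd, if_neg e1, if_neg e2, sub_zero, sub_zero, ← ite_and]
      refine if_congr ?_ rfl rfl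
      rw [nd.injEq]
      tauto
    rw [cutSum_congr h1 hc]
    split_ifs with hR
    · rfl
    · exact cutSum_zero _ _
  · have hc (a b : LabTree) (hab : IsCut false R a b) : pairInd (nd U V) B (nd L a) b =
        if L = U then pairInd V B a b else 0 := by
      have hb := hab.bounds h2
      have hle := hab.last_eq rfl
      have e1 : ¬(b = nd U V ∧ nd L a = B) := by
        rintro ⟨rfl, rfl⟩
        simp only [last] at *
        omega
      have e2 : ¬(b = V ∧ a = B) := by
        rintro ⟨rfl, rfl⟩
        omega
      rw [pairInd, pairInd, if_neg e1, if_neg e2, sub_zero, sub_zero, ← ite_and]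
      refine if_congr ?_ rfl rfl
      rw [nd.injEq]
      tauto
    rw [cutSum_congr h2 hc, cutSum_true_eq_false (pairInd_antisymm V B)]
    split_ifs with hL
    · rfl
    · exact cutSum_zero _ _

/-- The expansion of the commutator of two admissible trees in admissible trees. -/
def IsExpansion (A B : LabTree) (E : LabTree →₀ ℚ) : Prop :=
  (∀ T, T.Adm → E T = T.cutSum true (pairInd A B)) ∧ (∀ T, ¬T.Adm → E T = 0) ∧
    linearCombination ℚ ev E = brakW A.ev B.ev

theorem IsExpansion.neg {A B : LabTree} {E : LabTree →₀ ℚ} (h : IsExpansion A B E) :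
    IsExpansion B A (-E) := by
  refine ⟨fun T hT => ?_, fun T hT => ?_, ?_⟩
  · have e : pairInd B A = fun a b => -1 * pairInd A B a b := by
      ext a b
      rw [pairInd_swap B A]
      ring
    rw [e, cutSum_mul, Finsupp.neg_apply, h.1 T hT]
    ring
  · rw [Finsupp.neg_apply, h.2.1 T hT, neg_zero]
  · rw [map_neg, h.2.2, brakW_antisymm B.ev]

theorem nd_left_injective (V : LabTree) : Function.Injective fun T => nd T V :=
  fun _ _ h => (nd.inj h).1

theorem nd_right_injective (U : LabTree) : Function.Injective (nd U) :=
  fun _ _ h => (nd.inj h).2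

theorem mapDomain_nd_left_apply (E : LabTree →₀ ℚ) (V L R : LabTree) :
    mapDomain (fun T => nd T V) E (nd L R) = if R = V then E L else 0 := by
  split_ifs with h
  · subst h
    exact mapDomain_apply (nd_left_injective R) E L
  · refine mapDomain_of_notMem_range _ _ ?_
    rintro ⟨T, hT⟩
    exact h (nd.inj hT).2.symm

theorem mapDomain_nd_right_apply (E : LabTree →₀ ℚ) (U L R : LabTree) :
    mapDomain (nd U) E (nd L R) = if L = U then E R else 0 := by
  split_ifs with h
  · subst h
    exact mapDomain_apply (nd_right_injective L) E R
  · refine mapDomain_of_notMem_range _ _ ?_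
    rintro ⟨T, hT⟩
    exact h (nd.inj hT).1.symm

theorem linearCombination_nd_left (E : LabTree →₀ ℚ) (V : LabTree) :
    linearCombination ℚ ev (mapDomain (fun T => nd T V) E) =
      brakW (linearCombination ℚ ev E) V.ev := by
  rw [linearCombination_mapDomain, ← brakL_apply]
  simp [linearCombination_apply, Finsupp.sum, ev, ← brakL_apply]

theorem linearCombination_nd_right (E : LabTree →₀ ℚ) (U : LabTree) :
    linearCombination ℚ ev (mapDomain (nd U) E) =
      brakW U.ev (linearCombination ℚ ev E) := by
  rw [linearCombination_mapDomain, ← brakL_apply]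
  simp [linearCombination_apply, Finsupp.sum, ev, ← brakL_apply]

theorem IsExpansion.nd {U V B : LabTree} {E E' : LabTree →₀ ℚ} (hE : IsExpansion U B E)
    (hE' : IsExpansion V B E') (hA : (nd U V).Adm) (hB : B.Adm)
    (hd : Disjoint (nd U V).labels B.labels) (hf : U.first < B.first) (hl : B.last < V.last) :
    IsExpansion (nd U V) B (mapDomain (fun T => .nd T V) E + mapDomain (.nd U) E') := by
  have ⟨hU, hV, hUV, hf', hl'⟩ := hA
  rw [labels_nd, Finset.disjoint_union_left] at hd
  refine ⟨fun T hT => ?_, fun T hT => ?_, ?_⟩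
  · rw [Finsupp.add_apply]
    cases T with
    | leaf a =>
      rw [mapDomain_of_notMem_range, mapDomain_of_notMem_range] <;> simp [cutSum]
    | nd L R =>
      rw [mapDomain_nd_left_apply, mapDomain_nd_right_apply, cutSum_pairInd_nd hT hA hB hf hl,
        hE.1 L hT.1, hE'.1 R hT.2.1]
  · rw [Finsupp.add_apply]
    cases T with
    | leaf a => exact absurd trivial hT
    | nd L R =>
      rw [mapDomain_nd_left_apply, mapDomain_nd_right_apply]
      have e1 (h : R = V) : E L = 0 := by
        subst h
        by_contra hne
        have hL : L.Adm := not_imp_comm.1 (hE.2.1 L) hne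
        rw [hE.1 L hL] at hne
        have hlab := labels_of_cutSum_pairInd_ne_zero hL hne
        have b1 := hL.bounds U.first (hlab ▸ Finset.mem_union_left _ U.first_mem)
        have b2 := hlab ▸ L.last_mem
        refine hT ⟨hL, hV, ?_, by omega, ?_⟩
        · rw [hlab, Finset.disjoint_union_left]
          exact ⟨hUV, hd.2.symm⟩
        · rcases Finset.mem_union.1 b2 with b2 | b2
          · have := hU.bounds _ b2; omega
          · have := hB.bounds _ b2; omega
      have e2 (h : L = U) : E' R = 0 := by
        subst h
        by_contra hne
        have hR : R.Adm := not_imp_comm.1 (hE'.2.1 R) hne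
        rw [hE'.1 R hR] at hne
        have hlab := labels_of_cutSum_pairInd_ne_zero hR hne
        have b1 := hR.bounds V.last (hlab ▸ Finset.mem_union_left _ V.last_mem)
        have b2 := hlab ▸ R.first_mem
        refine hT ⟨hU, hR, ?_, ?_, by omega⟩
        · rw [hlab, Finset.disjoint_union_right]
          exact ⟨hUV, hd.1⟩
        · rcases Finset.mem_union.1 b2 with b2 | b2
          · have := hV.bounds _ b2; omega
          · have := hB.bounds _ b2; omega
      rw [ite_eq_right_iff.2 e1, ite_eq_right_iff.2 e2, add_zero]
  · rw [map_add, linearCombination_nd_left, linearCombination_nd_right, hE.2.2, hE'.2.2, ev,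
      brakW_jacobi U.ev V.ev]

theorem exists_isExpansion (A B : LabTree) (hA : A.Adm) (hB : B.Adm)
    (hd : Disjoint A.labels B.labels) : ∃ E, IsExpansion A B E := by
  induction hn : A.shape.nodes + B.shape.nodes using Nat.strong_induction_on generalizing A B with
  | _ n ih =>
  have hne {x y : ℕ} (hx : x ∈ A.labels) (hy : y ∈ B.labels) : x ≠ y :=
    Finset.disjoint_iff_ne.1 hd x hx y hy
  wlog hf : A.first < B.first generalizing A B
  · obtain ⟨E, hE⟩ := this B A hB hA hd.symm (by omega) (fun hx hy => (hne hy hx).symm)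
      (lt_of_le_of_ne (not_lt.1 hf) (hne A.first_mem B.first_mem).symm)
    exact ⟨-E, hE.neg⟩
  rcases lt_or_gt_of_ne (hne A.last_mem B.last_mem) with hl | hl
  · refine ⟨single (nd A B) 1, fun T hT => ?_, fun T hT => ?_, ?_⟩
    · rw [cutSum_pairInd_nested hT hf hl, single_apply]
      exact if_congr eq_comm rfl rfl
    · rw [single_apply, if_neg]
      rintro rfl
      exact hT ⟨hA, hB, hd, hf, hl⟩
    · rw [linearCombination_single, one_smul, ev]
  · cases A with
    | leaf a =>
      have := hB.bounds _ B.first_mem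
      simp only [first, last] at hf hl
      omega
    | nd U V =>
      have hd' := hd
      rw [labels_nd, Finset.disjoint_union_left] at hd'
      simp only [shape, BT.nodes] at hn
      obtain ⟨E, hE⟩ := ih _ (by omega) U B hA.1 hB hd'.1 rfl
      obtain ⟨E', hE'⟩ := ih _ (by omega) V B hA.2.1 hB hd'.2 rfl
      exact ⟨_, hE.nd hE' hA hB hd hf hl⟩

end LabTree

theorem mem_allBT {n : ℕ} {t : BT} : t ∈ allBT n ↔ t.nodes = n := by
  induction n using Nat.strong_induction_on generalizing t with
  | _ n ih =>
  cases n with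
  | zero =>
    rw [allBT, Finset.mem_singleton]
    cases t <;> simp [BT.nodes]
  | succ m =>
    rw [allBT]
    simp only [Finset.mem_biUnion, Finset.mem_attach, true_and, Subtype.exists, Finset.mem_range,
      Finset.mem_image, Finset.mem_product, Prod.exists]
    constructor
    · rintro ⟨k, hk, l, r, ⟨hl, hr⟩, rfl⟩
      rw [ih k hk] at hl
      rw [ih (m - k) (by omega)] at hr
      simp only [BT.nodes]
      omega
    · cases t with
      | nil => simp [BT.nodes]
      | nd l r =>
        intro h
        simp only [BT.nodes] at h
        refine ⟨l.nodes, by omega, l, r, ⟨(ih _ (by omega)).2 rfl, ?_⟩, rfl⟩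
        rw [ih (m - l.nodes) (by omega)]
        omega

theorem mem_permWords {n : ℕ} {w : List ℕ} :
    w ∈ permWords n ↔ w.Nodup ∧ w.toFinset = Finset.Icc 1 n := by
  have hI : (List.range' 1 n).toFinset = Finset.Icc 1 n := by
    ext x
    simp
    omega
  rw [permWords, List.mem_toFinset, List.mem_permutations]
  constructor
  · intro h
    exact ⟨h.nodup_iff.2 List.nodup_range', by rw [← hI, List.toFinset_eq_of_perm _ _ h]⟩
  · rintro ⟨h, h'⟩
    exact List.perm_of_nodup_nodup_toFinset_eq h List.nodup_range' (h'.trans hI.symm)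

namespace LabTree

open Finsupp

/-- The complete binary tree with internal nodes `t` and leaves labelled by the word `w`. -/
def ofWord : BT → List ℕ → LabTree
  | .nil, w => leaf w.headI
  | .nd l r, w => nd (ofWord l (w.take (l.nodes + 1))) (ofWord r (w.drop (l.nodes + 1)))

theorem shape_ofWord (t : BT) (w : List ℕ) : (ofWord t w).shape = t := by
  induction t generalizing w with
  | nil => rfl
  | nd l r hl hr => simp [ofWord, shape, hl, hr]

theorem word_ofWord {t : BT} {w : List ℕ} (h : w.length = t.nodes + 1) :
    (ofWord t w).word = w := by
  induction t generalizing w with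
  | nil =>
    obtain ⟨a, rfl⟩ := List.length_eq_one_iff.1 h
    rfl
  | nd l r hl hr =>
    simp only [BT.nodes] at h
    rw [ofWord, word, hl (by rw [List.length_take]; omega), hr (by rw [List.length_drop]; omega),
      List.take_append_drop]

theorem take_word_nd (l r : LabTree) : (nd l r).word.take (l.shape.nodes + 1) = l.word := by
  rw [← length_word, word, List.take_left]

theorem drop_word_nd (l r : LabTree) : (nd l r).word.drop (l.shape.nodes + 1) = r.word := by
  rw [← length_word, word, List.drop_left]

theorem ofWord_shape_word (T : LabTree) : ofWord T.shape T.word = T := by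
  induction T with
  | leaf a => rfl
  | nd l r hl hr => rw [shape, ofWord, take_word_nd, drop_word_nd, hl, hr]

theorem evalBT_shape_word (T : LabTree) : evalBT T.shape T.word = T.ev := by
  induction T with
  | leaf a => rfl
  | nd l r hl hr => rw [shape, evalBT, take_word_nd, drop_word_nd, hl, hr, ev]

theorem Adm.minimum_word {T : LabTree} (h : T.Adm) : T.word.minimum = WithTop.some T.first :=
  List.minimum_eq_coe_iff.2 ⟨List.mem_toFinset.1 T.first_mem,
    fun x hx => (h.bounds x (List.mem_toFinset.2 hx)).1⟩

theorem Adm.maximum_word {T : LabTree} (h : T.Adm) : T.word.maximum = WithBot.some T.last :=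
  List.maximum_eq_coe_iff.2 ⟨List.mem_toFinset.1 T.last_mem,
    fun x hx => (h.bounds x (List.mem_toFinset.2 hx)).2⟩

theorem admB_shape_word {T : LabTree} (h : T.word.Nodup) :
    admB T.shape T.word = true ↔ T.Adm := by
  induction T with
  | leaf a => simp [shape, admB, Adm]
  | nd l r hl hr =>
    rw [word, List.nodup_append'] at h
    have hd : Disjoint l.labels r.labels := List.disjoint_toFinset_iff_disjoint.2 h.2.2
    have hf : l.first ≠ r.first := Finset.disjoint_iff_ne.1 hd _ l.first_mem _ r.first_mem
    have hla : l.last ≠ r.last := Finset.disjoint_iff_ne.1 hd _ l.last_mem _ r.last_mem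
    rw [shape, admB, take_word_nd, drop_word_nd]
    simp only [Bool.and_eq_true, decide_eq_true_eq, hl h.1, hr h.2.1, Adm, and_assoc]
    refine and_congr_right fun al => and_congr_right fun ar => ?_
    rw [word, List.minimum_append, List.maximum_append, al.minimum_word, ar.minimum_word,
      al.maximum_word, ar.maximum_word, eq_comm, min_eq_left_iff, eq_comm, max_eq_right_iff,
      WithTop.coe_le_coe, WithBot.coe_le_coe]
    simp only [hd, true_and]
    omega

open scoped Classical in
/-- The finite set of admissible trees with label set `K`. -/
noncomputable def admSet (K : Finset ℕ) : Finset LabTree :=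
  ((allBT (K.card - 1) ×ˢ K.toList.permutations.toFinset).image fun p => ofWord p.1 p.2).filter
    fun T => T.Adm ∧ T.labels = K

theorem mem_admSet {K : Finset ℕ} {T : LabTree} : T ∈ admSet K ↔ T.Adm ∧ T.labels = K := by
  classical
  rw [admSet, Finset.mem_filter, and_iff_right_iff_imp]
  rintro ⟨h, rfl⟩
  refine Finset.mem_image.2 ⟨(T.shape, T.word), ?_, T.ofWord_shape_word⟩
  rw [Finset.mem_product, mem_allBT, labels, List.toFinset_card_of_nodup h.nodup_word,
    length_word, List.mem_toFinset, List.mem_permutations]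
  refine ⟨rfl, List.perm_of_nodup_nodup_toFinset_eq h.nodup_word (Finset.nodup_toList _) ?_⟩
  rw [Finset.toList_toFinset]

theorem sum_admSet_shape (n : ℕ) (g : BT → ℚ) :
    ∑ T ∈ admSet (Finset.Icc 1 (n + 1)), g T.shape • T.ev =
      ∑ t ∈ allBT n, g t • (cElt t : FW ℚ) := by
  simp only [cElt, Finset.smul_sum]
  rw [Finset.sum_sigma']
  have hlen {w : List ℕ} (h : w.Nodup ∧ w.toFinset = Finset.Icc 1 (n + 1)) :
      w.length = n + 1 := by
    rw [← List.toFinset_card_of_nodup h.1, h.2, Nat.card_Icc]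
    omega
  refine Finset.sum_bij' (fun T _ => ⟨T.shape, T.word⟩) (fun p _ => ofWord p.1 p.2)
    (fun T hT => ?_) (fun p hp => ?_) (fun T _ => T.ofWord_shape_word) (fun p hp => ?_)
    (fun T _ => by rw [evalBT_shape_word])
  · obtain ⟨h, hK⟩ := mem_admSet.1 hT
    have hw : T.word.Nodup ∧ T.word.toFinset = Finset.Icc 1 (n + 1) := ⟨h.nodup_word, hK⟩
    have hn : T.shape.nodes = n := by
      have := hlen hw
      rw [length_word] at this
      omega
    rw [Finset.mem_sigma, Finset.mem_filter, mem_permWords, mem_allBT, hn]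
    exact ⟨rfl, hw, (admB_shape_word h.nodup_word).2 h⟩
  all_goals
    obtain ⟨t, w⟩ := p
    rw [Finset.mem_sigma, Finset.mem_filter, mem_permWords, mem_allBT] at hp
    obtain ⟨ht, hw, ha⟩ := hp
    simp only at ht hw ha
    rw [ht] at hw
    have e := word_ofWord (t := t) (w := w) (by rw [hlen hw, ht])
  · refine mem_admSet.2 ⟨?_, ?_⟩
    · rw [← admB_shape_word (by rw [e]; exact hw.1), shape_ofWord, e]
      exact ha
    · rw [labels, e, hw.2]
  · simp [shape_ofWord, e]

/-- Applying a function to all labels. -/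
def map (f : ℕ → ℕ) : LabTree → LabTree
  | leaf a => leaf (f a)
  | nd l r => nd (l.map f) (r.map f)

theorem shape_map (f : ℕ → ℕ) (T : LabTree) : (T.map f).shape = T.shape := by
  induction T with
  | leaf a => rfl
  | nd l r hl hr => rw [map, shape, hl, hr, shape]

theorem labels_map (f : ℕ → ℕ) (T : LabTree) : (T.map f).labels = T.labels.image f := by
  induction T with
  | leaf a => rfl
  | nd l r hl hr => rw [map, labels_nd, hl, hr, labels_nd, Finset.image_union]

theorem first_map (f : ℕ → ℕ) (T : LabTree) : (T.map f).first = f T.first := by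
  induction T with
  | leaf a => rfl
  | nd l r hl hr => rw [map, first, hl, first]

theorem last_map (f : ℕ → ℕ) (T : LabTree) : (T.map f).last = f T.last := by
  induction T with
  | leaf a => rfl
  | nd l r hl hr => rw [map, last, hr, last]

theorem ev_map (f : ℕ → ℕ) (T : LabTree) : (T.map f).ev = mapDomain (List.map f) T.ev := by
  induction T with
  | leaf a => simp [map, ev, mapDomain_single]
  | nd l r hl hr => rw [map, ev, hl, hr, ev, mapDomain_brakW]

theorem map_map_eq_self {f g : ℕ → ℕ} {T : LabTree} (h : ∀ x ∈ T.labels, g (f x) = x) :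
    (T.map f).map g = T := by
  induction T with
  | leaf a => simp [map, h a (by simp)]
  | nd l r hl hr =>
    simp only [labels_nd, Finset.mem_union] at h
    rw [map, map, hl fun x hx => h x (.inl hx), hr fun x hx => h x (.inr hx)]

theorem Adm.map {f : ℕ → ℕ} {T : LabTree} (h : T.Adm) (hf : StrictMonoOn f T.labels) :
    (T.map f).Adm := by
  induction T with
  | leaf a => trivial
  | nd l r hl hr =>
    obtain ⟨h1, h2, h3, h4, h5⟩ := h
    rw [labels_nd, Finset.coe_union] at hf
    refine ⟨hl h1 (hf.mono Set.subset_union_left), hr h2 (hf.mono Set.subset_union_right),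
      ?_, ?_, ?_⟩
    · rw [labels_map, labels_map, ← Finset.disjoint_coe, Finset.coe_image, Finset.coe_image]
      exact (Finset.disjoint_coe.2 h3).image hf.injOn Set.subset_union_left Set.subset_union_right
    · rw [first_map, first_map]
      exact hf (.inl l.first_mem) (.inr r.first_mem) h4
    · rw [last_map, last_map]
      exact hf (.inl l.last_mem) (.inr r.last_mem) h5

theorem ev_map_apply {f : ℕ → ℕ} {T : LabTree} (hf : Set.InjOn f T.labels) {w : List ℕ}
    (hw : w.toFinset = T.labels) : (T.map f).ev (w.map f) = T.ev w := by
  rw [ev_map]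
  refine mapDomain_apply' {u | ∀ a ∈ u, a ∈ T.labels} _ (fun u hu => ?_) ?_ ?_
  · intro a ha
    rw [← toFinset_of_ev_ne_zero (mem_support_iff.1 hu), List.mem_toFinset]
    exact ha
  · intro u hu v hv huv
    have hinv {u : List ℕ} (hu : ∀ a ∈ u, a ∈ T.labels) :
        (u.map f).map (Function.invFunOn f T.labels) = u := by
      rw [List.map_map]
      exact (List.map_congr_left fun a ha => hf.leftInvOn_invFunOn (hu a ha)).trans u.map_id
    rw [← hinv hu, huv, hinv hv]
  · intro a ha
    rw [← hw, List.mem_toFinset]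
    exact ha

end LabTree

/-- The rank of `x` in the word `w`. -/
def rank (w : List ℕ) (x : ℕ) : ℕ := (w.filter (· ≤ x)).length

theorem stdW_eq_map_rank (w : List ℕ) : stdW w = w.map (rank w) := rfl

theorem rank_strictMonoOn (w : List ℕ) : StrictMonoOn (rank w) w.toFinset := by
  intro x _ y hy hxy
  have e : w.filter (· ≤ x) = (w.filter (· ≤ y)).filter (· ≤ x) := by
    rw [List.filter_filter]
    refine List.filter_congr fun z _ => ?_
    by_cases hz : z ≤ x
    · simp [hz, hz.trans hxy.le]
    · simp [hz]
  rw [rank, e, rank, List.length_filter_lt_length_iff_exists]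
  refine ⟨y, List.mem_filter.2 ⟨List.mem_toFinset.1 hy, by simp⟩, by simpa using hxy⟩

theorem image_rank {w : List ℕ} (hw : w.Nodup) :
    w.toFinset.image (rank w) = Finset.Icc 1 w.length := by
  refine Finset.eq_of_subset_of_card_le (fun y hy => ?_) ?_
  · obtain ⟨x, hx, rfl⟩ := Finset.mem_image.1 hy
    refine Finset.mem_Icc.2 ⟨List.length_pos_of_mem (a := x) ?_, List.length_filter_le _ _⟩
    exact List.mem_filter.2 ⟨List.mem_toFinset.1 hx, by simp⟩
  · rw [Finset.card_image_of_injOn (rank_strictMonoOn w).injOn, List.toFinset_card_of_nodup hw,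
      Nat.card_Icc]
    omega

namespace LabTree

open Finsupp

theorem sum_ev_stdW (g : BT → ℚ) {w : List ℕ} (hw : w.Nodup) :
    ∑ T ∈ admSet (Finset.Icc 1 w.length), g T.shape * T.ev (stdW w) =
      ∑ T ∈ admSet w.toFinset, g T.shape * T.ev w := by
  have hmono := rank_strictMonoOn w
  have himg := image_rank hw
  have hinv : ∀ x ∈ w.toFinset, Function.invFunOn (rank w) w.toFinset (rank w x) = x :=
    fun x hx => hmono.injOn.leftInvOn_invFunOn hx
  have hrinv : ∀ y ∈ Finset.Icc 1 w.length,
      Function.invFunOn (rank w) w.toFinset y ∈ w.toFinset ∧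
        rank w (Function.invFunOn (rank w) w.toFinset y) = y := by
    intro y hy
    rw [← himg] at hy
    obtain ⟨x, hx, rfl⟩ := Finset.mem_image.1 hy
    rw [hinv x hx]
    exact ⟨hx, rfl⟩
  symm
  refine Finset.sum_nbij' (fun T => T.map (rank w))
    (fun T => T.map (Function.invFunOn (rank w) w.toFinset)) ?_ ?_ ?_ ?_ ?_
  · intro T hT
    obtain ⟨h, hK⟩ := mem_admSet.1 hT
    exact mem_admSet.2 ⟨h.map (hK ▸ hmono), by rw [labels_map, hK, himg]⟩
  · intro T hT
    obtain ⟨h, hK⟩ := mem_admSet.1 hT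
    refine mem_admSet.2 ⟨h.map ?_, ?_⟩
    · rw [hK]
      intro x hx y hy hxy
      have hx' := hrinv x hx
      have hy' := hrinv y hy
      rw [← hmono.lt_iff_lt hx'.1 hy'.1, hx'.2, hy'.2]
      exact hxy
    · rw [labels_map, hK, ← himg, Finset.image_image]
      exact (Finset.image_congr fun x hx => hinv x hx).trans Finset.image_id
  · intro T hT
    exact map_map_eq_self fun x hx => hinv x ((mem_admSet.1 hT).2 ▸ hx)
  · intro T hT
    exact map_map_eq_self fun x hx => (hrinv x ((mem_admSet.1 hT).2 ▸ hx)).2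
  · intro T hT
    have hK := (mem_admSet.1 hT).2
    rw [shape_map, stdW_eq_map_rank, ev_map_apply (hK ▸ hmono.injOn) hK.symm]

/-- The pairs of admissible trees whose label sets partition `{1, …, N}`. -/
noncomputable def pairSet (N : ℕ) : Finset (LabTree × LabTree) :=
  (Finset.Icc 1 N).powerset.biUnion fun K => admSet K ×ˢ admSet (Finset.Icc 1 N \ K)

theorem mem_pairSet {N : ℕ} {p : LabTree × LabTree} :
    p ∈ pairSet N ↔ p.1.Adm ∧ p.2.Adm ∧ Disjoint p.1.labels p.2.labels ∧
      p.1.labels ∪ p.2.labels = Finset.Icc 1 N := by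
  simp only [pairSet, Finset.mem_biUnion, Finset.mem_powerset, Finset.mem_product, mem_admSet]
  constructor
  · rintro ⟨K, hK, ⟨h1, rfl⟩, h2, h3⟩
    rw [h3]
    exact ⟨h1, h2, Finset.disjoint_sdiff, Finset.union_sdiff_of_subset hK⟩
  · rintro ⟨h1, h2, hd, hu⟩
    refine ⟨p.1.labels, hu ▸ Finset.subset_union_left, ⟨h1, rfl⟩, h2, ?_⟩
    rw [← hu, Finset.union_sdiff_cancel_left hd]

theorem swap_mem_pairSet {N : ℕ} {p : LabTree × LabTree} (h : p ∈ pairSet N) :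
    p.swap ∈ pairSet N := by
  obtain ⟨h1, h2, hd, hu⟩ := mem_pairSet.1 h
  exact mem_pairSet.2 ⟨h2, h1, hd.symm, by rw [← hu, Finset.union_comm]; rfl⟩

/-- The generating element of admissible trees on `{1, …, n + 1}` weighted by their shape. -/
noncomputable def shapeSum (n : ℕ) (g : BT → ℚ) : FW ℚ :=
  ∑ T ∈ admSet (Finset.Icc 1 (n + 1)), g T.shape • T.ev

theorem shapeSum_apply (n : ℕ) (g : BT → ℚ) (w : List ℕ) :
    shapeSum n g w = ∑ T ∈ admSet (Finset.Icc 1 (n + 1)), g T.shape * T.ev w := by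
  simp [shapeSum, finsetSum_apply]

theorem length_of_shapeSum_ne_zero {n : ℕ} {g : BT → ℚ} (hg : ∀ t, g t ≠ 0 → t.nodes = n)
    {w : List ℕ} (h : shapeSum n g w ≠ 0) : w.length = n + 1 := by
  rw [shapeSum_apply] at h
  obtain ⟨T, -, hT⟩ := Finset.exists_ne_zero_of_sum_ne_zero h
  rw [length_of_ev_ne_zero (right_ne_zero_of_mul hT), hg _ (left_ne_zero_of_mul hT)]

theorem starW_shapeSum {m n : ℕ} {g h : BT → ℚ} (hg : ∀ t, g t ≠ 0 → t.nodes = m)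
    (hh : ∀ t, h t ≠ 0 → t.nodes = n) :
    starW (shapeSum m g) (shapeSum n h) =
      ∑ p ∈ pairSet (m + 1 + (n + 1)),
        (g p.1.shape * h p.2.shape) • catW p.1.ev p.2.ev := by
  ext w
  have hterm (p : LabTree × LabTree) :
      ((g p.1.shape * h p.2.shape) • catW p.1.ev p.2.ev) w =
        (g p.1.shape * p.1.ev (w.take (m + 1))) * (h p.2.shape * p.2.ev (w.drop (m + 1))) := by
    by_cases h0 : g p.1.shape = 0
    · simp [h0]
    · rw [Finsupp.smul_apply, smul_eq_mul,
        catW_apply_of_length (m := m + 1) fun u hu => by rw [length_of_ev_ne_zero hu, hg _ h0]]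
      ring
  rw [starW_apply_of_length (fun u => length_of_shapeSum_ne_zero hg)
    (fun u => length_of_shapeSum_ne_zero hh), finsetSum_apply]
  simp only [hterm]
  split_ifs with hw
  · obtain ⟨hnd, hw⟩ := mem_permWords.1 hw
    have hlen : w.length = m + 1 + (n + 1) := by
      rw [← List.toFinset_card_of_nodup hnd, hw, Nat.card_Icc]
      omega
    have hl : (w.take (m + 1)).length = m + 1 := by rw [List.length_take]; omega
    have hr : (w.drop (m + 1)).length = n + 1 := by rw [List.length_drop]; omega
    rw [← List.take_append_drop (m + 1) w, List.nodup_append'] at hnd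
    rw [← List.take_append_drop (m + 1) w, List.toFinset_append] at hw
    have e1 := sum_ev_stdW g hnd.1
    have e2 := sum_ev_stdW h hnd.2.1
    rw [hl] at e1
    rw [hr] at e2
    rw [shapeSum_apply, shapeSum_apply, e1, e2, Finset.sum_mul_sum, ← Finset.sum_product']
    refine Finset.sum_subset (fun p hp => ?_) fun p hp' hp => ?_
    · obtain ⟨h1, h2⟩ := Finset.mem_product.1 hp
      obtain ⟨h1, k1⟩ := mem_admSet.1 h1
      obtain ⟨h2, k2⟩ := mem_admSet.1 h2
      refine mem_pairSet.2 ⟨h1, h2, ?_, by rw [k1, k2, hw]⟩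
      rw [k1, k2]
      exact List.disjoint_toFinset_iff_disjoint.2 hnd.2.2
    · by_contra hne
      refine hp (Finset.mem_product.2 ⟨mem_admSet.2 ⟨?_, ?_⟩, mem_admSet.2 ⟨?_, ?_⟩⟩)
      · exact (mem_pairSet.1 hp').1
      · exact (toFinset_of_ev_ne_zero (right_ne_zero_of_mul (left_ne_zero_of_mul hne))).symm
      · exact (mem_pairSet.1 hp').2.1
      · exact (toFinset_of_ev_ne_zero (right_ne_zero_of_mul (right_ne_zero_of_mul hne))).symm
  · symm
    refine Finset.sum_eq_zero fun p hp => ?_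
    by_contra hne
    obtain ⟨h1, h2, hd, hu⟩ := mem_pairSet.1 hp
    have q1 := perm_of_ev_ne_zero (right_ne_zero_of_mul (left_ne_zero_of_mul hne))
    have q2 := perm_of_ev_ne_zero (right_ne_zero_of_mul (right_ne_zero_of_mul hne))
    have q := q1.append q2
    rw [List.take_append_drop] at q
    refine hw (mem_permWords.2 ⟨q.nodup_iff.2 ?_, ?_⟩)
    · exact h1.nodup_word.append h2.nodup_word (List.disjoint_toFinset_iff_disjoint.1 hd)
    · rw [List.toFinset_eq_of_perm _ _ q, List.toFinset_append]
      exact hu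

theorem brakW_eq_sum_admSet {N : ℕ} {p : LabTree × LabTree} (hp : p ∈ pairSet N) :
    brakW p.1.ev p.2.ev =
      ∑ T ∈ admSet (Finset.Icc 1 N), T.cutSum true (pairInd p.1 p.2) • T.ev := by
  obtain ⟨h1, h2, hd, hu⟩ := mem_pairSet.1 hp
  obtain ⟨E, hE, hE', hsum⟩ := exists_isExpansion p.1 p.2 h1 h2 hd
  rw [← hsum, linearCombination_apply, Finsupp.sum_of_support_subset E (s := admSet _) _ _ (by simp)]
  · exact Finset.sum_congr rfl fun T hT => by rw [hE T (mem_admSet.1 hT).1]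
  · intro T hT
    have hne := mem_support_iff.1 hT
    have hA : T.Adm := not_imp_comm.1 (hE' T) hne
    rw [hE T hA] at hne
    exact mem_admSet.2 ⟨hA, (labels_of_cutSum_pairInd_ne_zero hA hne).trans hu⟩

theorem sum_pairSet_mul_pairInd {N : ℕ} (g h : BT → ℚ) {a b : LabTree}
    (hab : (a, b) ∈ pairSet N) :
    ∑ p ∈ pairSet N, g p.1.shape * h p.2.shape * pairInd p.1 p.2 a b =
      g a.shape * h b.shape - g b.shape * h a.shape := by
  have e (p : LabTree × LabTree) : pairInd p.1 p.2 a b =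
      (if (a, b) = p then 1 else 0) - if (b, a) = p then 1 else 0 := by
    simp [pairInd, Prod.ext_iff]
  simp only [e, mul_sub, mul_ite, mul_one, mul_zero, Finset.sum_sub_distrib, Finset.sum_ite_eq,
    if_pos hab, if_pos (show (b, a) ∈ pairSet N from swap_mem_pairSet hab)]

theorem starW_shapeSum_sub {m n : ℕ} {g h : BT → ℚ} (hg : ∀ t, g t ≠ 0 → t.nodes = m)
    (hh : ∀ t, h t ≠ 0 → t.nodes = n) :
    starW (shapeSum m g) (shapeSum n h) - starW (shapeSum n h) (shapeSum m g) =
      shapeSum (m + 1 + n) fun t => t.cutSum true fun a b => g a * h b - g b * h a := by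
  have hN : n + 1 + (m + 1) = m + 1 + (n + 1) := by omega
  have hswap : starW (shapeSum n h) (shapeSum m g) =
      ∑ p ∈ pairSet (m + 1 + (n + 1)),
        (g p.1.shape * h p.2.shape) • catW p.2.ev p.1.ev := by
    rw [starW_shapeSum hh hg, hN]
    exact Finset.sum_nbij' Prod.swap Prod.swap (fun p => swap_mem_pairSet)
      (fun p => swap_mem_pairSet) (fun p _ => p.swap_swap) (fun p _ => p.swap_swap)
      fun p _ => by rw [mul_comm]; rfl
  rw [hswap, starW_shapeSum hg hh, ← Finset.sum_sub_distrib]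
  simp only [← smul_sub]
  calc
    _ = ∑ p ∈ pairSet (m + 1 + (n + 1)), ∑ T ∈ admSet (Finset.Icc 1 (m + 1 + (n + 1))),
          (g p.1.shape * h p.2.shape * T.cutSum true (pairInd p.1 p.2)) • T.ev := by
      refine Finset.sum_congr rfl fun p hp => ?_
      rw [show catW p.1.ev p.2.ev - catW p.2.ev p.1.ev = brakW p.1.ev p.2.ev from rfl,
        brakW_eq_sum_admSet hp, Finset.smul_sum]
      simp only [smul_smul]
    _ = _ := by
      rw [Finset.sum_comm]
      refine Finset.sum_congr rfl fun T hT => ?_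
      obtain ⟨hA, hK⟩ := mem_admSet.1 hT
      simp only [← cutSum_mul]
      rw [← Finset.sum_smul, ← cutSum_sum, ← cutSum_shape]
      congr 1
      refine cutSum_congr hA fun a b hab => sum_pairSet_mul_pairInd g h ?_
      exact mem_pairSet.2 ⟨hab.adm_left, hab.adm_right, hab.disjoint, hab.union.trans hK⟩

end LabTree

open scoped Classical in
/-- The indicator function of the LR-class of `t`. -/
noncomputable def classInd (t s : BT) : ℚ := if LREquiv t s then 1 else 0

theorem classInd_congr {t s s' : BT} (h : LREquiv s s') : classInd t s = classInd t s' := by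
  classical
  exact if_congr ⟨fun h' => h'.trans _ _ _ h, fun h' => h'.trans _ _ _ (h.symm _ _)⟩ rfl rfl

theorem classInd_comm (t s : BT) : classInd t s = classInd s t := by
  classical
  exact if_congr ⟨.symm _ _, .symm _ _⟩ rfl rfl

theorem nodes_eq_of_classInd_ne_zero {t s : BT} (h : classInd t s ≠ 0) : s.nodes = t.nodes := by
  by_contra hne
  exact h (if_neg fun h' => hne h'.nodes_eq.symm)

theorem LRclassSum_eq_sum (t : BT) :
    LRclassSum t = ∑ s ∈ allBT t.nodes, classInd t s • (cElt s : FW ℚ) := by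
  classical
  rw [LRclassSum, Finset.sum_filter]
  exact Finset.sum_congr rfl fun s _ => by rw [classInd, ite_smul, one_smul, zero_smul]

theorem LRclassSum_eq_shapeSum (t : BT) :
    LRclassSum t = LabTree.shapeSum t.nodes (classInd t) := by
  rw [LRclassSum_eq_sum, LabTree.shapeSum, LabTree.sum_admSet_shape]

theorem shapeSum_mem_span {n : ℕ} {g : BT → ℚ} (hg : ∀ t t', LREquiv t t' → g t = g t') :
    LabTree.shapeSum n g ∈ Submodule.span ℚ (Set.range LRclassSum) := by
  have hc (s : BT) (hs : s ∈ allBT n) : ∑ t ∈ allBT n, classInd s t ≠ 0 := by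
    refine (Finset.sum_pos' (fun t _ => ?_) ⟨s, hs, ?_⟩).ne'
    · rw [classInd]
      split_ifs <;> simp
    · rw [classInd, if_pos (.refl s)]
      exact one_pos
  have key : LabTree.shapeSum n g =
      ∑ t ∈ allBT n, (g t / ∑ r ∈ allBT n, classInd t r) • LRclassSum t := by
    calc
      _ = ∑ s ∈ allBT n, ∑ t ∈ allBT n,
            (g t / (∑ r ∈ allBT n, classInd t r) * classInd t s) • (cElt s : FW ℚ) := by
        rw [LabTree.shapeSum, LabTree.sum_admSet_shape]
        refine Finset.sum_congr rfl fun s hs => ?_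
        rw [← Finset.sum_smul]
        congr 1
        have e (t : BT) : g t / (∑ r ∈ allBT n, classInd t r) * classInd t s =
            g s / (∑ r ∈ allBT n, classInd s r) * classInd s t := by
          by_cases h : LREquiv t s
          · have hts : classInd t = classInd s :=
              funext fun r => by rw [classInd_comm t, classInd_comm s, classInd_congr h]
            rw [hg t s h, hts, classInd_congr h]
          · rw [classInd_comm s t, classInd, if_neg h, mul_zero, mul_zero]
        simp only [e]
        rw [← Finset.mul_sum, div_mul_cancel₀ _ (hc s hs)]
      _ = _ := by
        rw [Finset.sum_comm]
        refine Finset.sum_congr rfl fun t ht => ?_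
        rw [LRclassSum_eq_sum, mem_allBT.1 ht, Finset.smul_sum]
        simp only [smul_smul]
  rw [key]
  exact Submodule.sum_mem _ fun t _ =>
    Submodule.smul_mem _ _ (Submodule.subset_span ⟨t, rfl⟩)

theorem stmt18 : ∀ t1 t2 : BT,
    starW (LRclassSum t1) (LRclassSum t2) - starW (LRclassSum t2) (LRclassSum t1)
      ∈ Submodule.span ℚ (Set.range LRclassSum) := by
  intro t1 t2
  rw [LRclassSum_eq_shapeSum, LRclassSum_eq_shapeSum,
    LabTree.starW_shapeSum_sub (fun _ => nodes_eq_of_classInd_ne_zero)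
      (fun _ => nodes_eq_of_classInd_ne_zero)]
  refine shapeSum_mem_span fun t t' h => h.cutSum_eq (fun a b => by ring) fun a a' b ha => ?_
  rw [classInd_congr ha, classInd_congr ha]
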